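/- arXiv:math/0606330 — 3 statements merged into one kernel-verified Lean document; each statement's English description precedes it below -/
import Mathlib

section
/- Let T ∈ ℚ[[P,Q]] be the formal power series whose coefficient of P^rQ^s equals (−1)^{r+s}/(r+s−1) for all r,s ≥ 1 and equals 0 otherwise (i.e. T = ∑_{m≥1} ((−1)^{m−1}/m) ∑_{r+s=m+1, r,s≥1} P^r Q^s). Then (P − Q)·T = P·Q·(log(1+P) − log(1+Q)) in ℚ[[P,Q]]. -/
/-!
We work in `ℚ[[P,Q]] = MvPowerSeries (Fin 2) ℚ`, where `P = MvPowerSeries.X 0` and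
`Q = MvPowerSeries.X 1`.
-/

noncomputable section

/-- The series `T = ∑_{m≥1} ((−1)^{m−1}/m) ∑_{r+s=m+1, r,s≥1} P^r Q^s`, defined by its
coefficients: the coefficient of `P^r Q^s` is `(−1)^{r+s}/(r+s−1)` for `r,s ≥ 1`
and `0` otherwise. -/
def T : MvPowerSeries (Fin 2) ℚ :=
  fun d => if 1 ≤ d 0 ∧ 1 ≤ d 1 then (-1 : ℚ) ^ (d 0 + d 1) / ((d 0 + d 1 - 1 : ℕ) : ℚ) else 0

/-- `log(1+P) = ∑_{n≥1} (−1)^{n−1} P^n / n`, defined by its coefficients. -/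
def logOneAddP : MvPowerSeries (Fin 2) ℚ :=
  fun d => if 1 ≤ d 0 ∧ d 1 = 0 then (-1 : ℚ) ^ (d 0 - 1) / ((d 0 : ℕ) : ℚ) else 0

/-- `log(1+Q) = ∑_{n≥1} (−1)^{n−1} Q^n / n`, defined by its coefficients. -/
def logOneAddQ : MvPowerSeries (Fin 2) ℚ :=
  fun d => if 1 ≤ d 1 ∧ d 0 = 0 then (-1 : ℚ) ^ (d 1 - 1) / ((d 1 : ℕ) : ℚ) else 0

theorem MvPowerSeries.coeff_X_mul_eq_ite {σ R : Type*} [CommSemiring R]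
    (d : σ →₀ ℕ) (s : σ) (φ : MvPowerSeries σ R) :
    coeff d (X s * φ) = if 1 ≤ d s then coeff (d - Finsupp.single s 1) φ else 0 := by
  classical
  rw [X, coeff_monomial_mul]
  simp only [Finsupp.single_le_iff, one_mul]

theorem coeff_T (d : Fin 2 →₀ ℕ) :
    MvPowerSeries.coeff d T = if 1 ≤ d 0 ∧ 1 ≤ d 1 then
      (-1 : ℚ) ^ (d 0 + d 1) / ((d 0 + d 1 - 1 : ℕ) : ℚ) else 0 := rfl

theorem coeff_logOneAddP (d : Fin 2 →₀ ℕ) :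
    MvPowerSeries.coeff d logOneAddP = if 1 ≤ d 0 ∧ d 1 = 0 then
      (-1 : ℚ) ^ (d 0 - 1) / ((d 0 : ℕ) : ℚ) else 0 := rfl

theorem coeff_logOneAddQ (d : Fin 2 →₀ ℕ) :
    MvPowerSeries.coeff d logOneAddQ = if 1 ≤ d 1 ∧ d 0 = 0 then
      (-1 : ℚ) ^ (d 1 - 1) / ((d 1 : ℕ) : ℚ) else 0 := rfl

/-- Claim 3.3(b): `(P − Q)·T = P·Q·(log(1+P) − log(1+Q))` in `ℚ[[P,Q]]`. -/
theorem claim_3_3b :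
    (MvPowerSeries.X 0 - MvPowerSeries.X 1) * T =
      MvPowerSeries.X 0 * MvPowerSeries.X 1 * (logOneAddP - logOneAddQ) := by
  ext d
  rw [sub_mul, mul_assoc]
  simp only [map_sub, MvPowerSeries.coeff_X_mul_eq_ite, coeff_T, coeff_logOneAddP,
    coeff_logOneAddQ, Finsupp.tsub_apply, Finsupp.single_eq_same,
    Finsupp.single_eq_of_ne (zero_ne_one : (0 : Fin 2) ≠ 1),
    Finsupp.single_eq_of_ne (one_ne_zero : (1 : Fin 2) ≠ 0), tsub_zero]
  generalize d 0 = a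
  generalize d 1 = b
  rcases a with _ | _ | a <;> rcases b with _ | _ | b <;> simp [pow_succ] <;> ring

end
end

section
/- Let L be the free Lie algebra over ℚ on two generators X, Y, and let I = ⁅⁅L,L⁆,⁅L,L⁆⁆ be the Lie ideal generated by all brackets of brackets (the second derived ideal). Then the family of elements of the Lie algebra quotient L/I consisting of the images of X, of Y, and of the long commutators (ad X)^k((ad Y)^l(⁅X,Y⁆)) for all k,l ≥ 0, is a basis of L/I as a ℚ-vector space (it is linearly independent and spans). -/
noncomputable section

/-- The free Lie algebra over `ℚ` on two generators. -/
abbrev L := FreeLieAlgebra ℚ (Fin 2)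

/-- The generator `X`. -/
def Xg : L := FreeLieAlgebra.of ℚ 0

/-- The generator `Y`. -/
def Yg : L := FreeLieAlgebra.of ℚ 1

/-- The second derived ideal `I = ⁅⁅L,L⁆,⁅L,L⁆⁆`. -/
abbrev I : LieIdeal ℚ L := LieAlgebra.derivedSeries ℚ L 2

/-- The family consisting of the images in `L/I` of `X`, `Y` and of the long commutators
`(ad X)^k ((ad Y)^l ⁅X,Y⁆)`, `k,l ≥ 0`. -/
def fam : Fin 2 ⊕ ℕ × ℕ → L ⧸ I :=
  Sum.elim
    ![LieSubmodule.Quotient.mk (N := I) Xg, LieSubmodule.Quotient.mk (N := I) Yg]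
    (fun p => LieSubmodule.Quotient.mk (N := I)
      ((LieAlgebra.ad ℚ L Xg ^ p.1) ((LieAlgebra.ad ℚ L Yg ^ p.2) ⁅Xg, Yg⁆)))

/-- The Lie algebra of affine transformations of a line over a commutative ring `A`:
the module `A × A` with bracket `⁅(a, b), (c, d)⁆ = (0, a * d - c * b)`. -/
def AffineLie (A : Type*) := A × A

namespace AffineLie

variable {A : Type*}

/-- The element of `AffineLie A` with the given components. -/
def mk (a b : A) : AffineLie A := (a, b)

@[ext] lemma ext {p q : AffineLie A} (h₁ : p.1 = q.1) (h₂ : p.2 = q.2) : p = q := Prod.ext h₁ h₂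

@[simp] lemma mk_fst (a b : A) : (mk a b).1 = a := rfl
@[simp] lemma mk_snd (a b : A) : (mk a b).2 = b := rfl

variable [CommRing A]

instance : AddCommGroup (AffineLie A) := inferInstanceAs (AddCommGroup (A × A))

instance {R : Type*} [CommRing R] [Algebra R A] : Module R (AffineLie A) :=
  inferInstanceAs (Module R (A × A))

instance : Bracket (AffineLie A) (AffineLie A) where
  bracket p q := mk 0 (p.1 * q.2 - q.1 * p.2)

@[simp] lemma zero_fst : (0 : AffineLie A).1 = 0 := rfl
@[simp] lemma zero_snd : (0 : AffineLie A).2 = 0 := rfl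
@[simp] lemma add_fst (p q : AffineLie A) : (p + q).1 = p.1 + q.1 := rfl
@[simp] lemma add_snd (p q : AffineLie A) : (p + q).2 = p.2 + q.2 := rfl
@[simp] lemma lie_fst (p q : AffineLie A) : ⁅p, q⁆.1 = 0 := rfl
@[simp] lemma lie_snd (p q : AffineLie A) : ⁅p, q⁆.2 = p.1 * q.2 - q.1 * p.2 := rfl

section
variable {R : Type*} [CommRing R] [Algebra R A]
@[simp] lemma smul_fst (r : R) (p : AffineLie A) : (r • p).1 = r • p.1 := rfl
@[simp] lemma smul_snd (r : R) (p : AffineLie A) : (r • p).2 = r • p.2 := rfl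
end

instance : LieRing (AffineLie A) where
  add_lie _ _ _ := by ext <;> simp; ring
  lie_add _ _ _ := by ext <;> simp; ring
  lie_self _ := by ext <;> simp
  leibniz_lie _ _ _ := by ext <;> simp; ring

variable (R : Type*) [CommRing R] [Algebra R A]

instance : LieAlgebra R (AffineLie A) where
  lie_smul _ _ _ := by ext <;> simp [smul_sub]

variable (A) in
/-- The first component, as a linear map. -/
def fst : AffineLie A →ₗ[R] A := LinearMap.fst R A A

variable (A) in
/-- The second component, as a linear map. -/
def snd : AffineLie A →ₗ[R] A := LinearMap.snd R A A

@[simp] lemma fst_apply (p : AffineLie A) : fst A R p = p.1 := rfl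
@[simp] lemma snd_apply (p : AffineLie A) : snd A R p = p.2 := rfl

variable (A) in
/-- The Lie ideal of translations. -/
def translations : LieIdeal R (AffineLie A) where
  __ := LinearMap.ker (fst A R)
  lie_mem {p q} _ := lie_fst p q

@[simp] lemma mem_translations {p : AffineLie A} : p ∈ translations A R ↔ p.1 = 0 := LinearMap.mem_ker (f := fst A R)

lemma derivedSeries_two : LieAlgebra.derivedSeries R (AffineLie A) 2 = ⊥ := by
  have h : LieAlgebra.derivedSeries R (AffineLie A) 1 ≤ translations A R := by
    rw [LieAlgebra.derivedSeries_def, LieAlgebra.derivedSeriesOfIdeal_succ,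
      LieSubmodule.lie_le_iff]
    simp
  rw [eq_bot_iff, LieAlgebra.derivedSeries_def, LieAlgebra.derivedSeriesOfIdeal_succ,
    LieSubmodule.lie_le_iff]
  intro p hp q hq
  have hp' : p.1 = 0 := (mem_translations R).1 (h hp)
  have hq' : q.1 = 0 := (mem_translations R).1 (h hq)
  rw [LieSubmodule.mem_bot]
  ext <;> simp [hp', hq']

end AffineLie

lemma FreeLieAlgebra.lieSubalgebra_eq_top {R σ : Type*} [CommRing R]
    (K : LieSubalgebra R (FreeLieAlgebra R σ)) (h : ∀ i, FreeLieAlgebra.of R i ∈ K) : K = ⊤ := by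
  let f : FreeLieAlgebra R σ →ₗ⁅R⁆ K := FreeLieAlgebra.lift R fun i => ⟨.of R i, h i⟩
  have hf : K.incl.comp f = (LieHom.id : FreeLieAlgebra R σ →ₗ⁅R⁆ FreeLieAlgebra R σ) :=
    FreeLieAlgebra.hom_ext fun i => by simp [f]
  refine eq_top_iff.2 fun z _ => ?_
  have hz : (f z : FreeLieAlgebra R σ) = z := LieHom.congr_fun hf z
  exact hz ▸ (f z).2

/-- The long commutator `(ad X)^k ((ad Y)^l ⁅X, Y⁆)`. -/
def longComm (k l : ℕ) : L :=
  (LieAlgebra.ad ℚ L Xg ^ k) ((LieAlgebra.ad ℚ L Yg ^ l) ⁅Xg, Yg⁆)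

lemma longComm_zero_zero : longComm 0 0 = ⁅Xg, Yg⁆ := rfl

lemma lie_Xg_longComm (k l : ℕ) : ⁅Xg, longComm k l⁆ = longComm (k + 1) l := by
  simp [longComm, pow_succ']

lemma lie_Yg_longComm_zero (l : ℕ) : ⁅Yg, longComm 0 l⁆ = longComm 0 (l + 1) := by
  simp [longComm, pow_succ']

lemma longComm_mem_derivedSeries_one (k l : ℕ) :
    longComm k l ∈ LieAlgebra.derivedSeries ℚ L 1 := by
  induction k with
  | succ k ih => exact lie_Xg_longComm k l ▸ LieSubmodule.lie_mem _ ih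
  | zero =>
    induction l with
    | succ l ih => exact lie_Yg_longComm_zero l ▸ LieSubmodule.lie_mem _ ih
    | zero =>
      rw [LieAlgebra.derivedSeries_def, LieAlgebra.derivedSeriesOfIdeal_succ]
      exact LieSubmodule.lie_mem_lie (LieSubmodule.mem_top (R := ℚ) Xg)
        (LieSubmodule.mem_top (R := ℚ) Yg)

lemma lie_Yg_longComm_sub_mem (k l : ℕ) : ⁅Yg, longComm k l⁆ - longComm k (l + 1) ∈ I := by
  induction k with
  | zero => simp [lie_Yg_longComm_zero]
  | succ k ih =>
    have h : ⁅⁅Yg, Xg⁆, longComm k l⁆ ∈ I := by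
      rw [I, LieAlgebra.derivedSeries_def, LieAlgebra.derivedSeriesOfIdeal_succ]
      refine LieSubmodule.lie_mem_lie ?_ (longComm_mem_derivedSeries_one k l)
      rw [← lie_skew]
      exact neg_mem (longComm_mem_derivedSeries_one 0 0)
    rw [← lie_Xg_longComm, ← lie_Xg_longComm, leibniz_lie, add_sub_assoc, ← lie_sub]
    exact add_mem h (LieSubmodule.lie_mem _ ih)

/-- The subspace of `L` generated by `X`, `Y`, the long commutators and the second derived
ideal. -/
def famSpan : Submodule ℚ L :=
  (Submodule.span ℚ (Set.range fam)).comap (LieSubmodule.Quotient.mk' I : L →ₗ[ℚ] L ⧸ I)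

lemma mem_famSpan {z : L} :
    z ∈ famSpan ↔ LieSubmodule.Quotient.mk (N := I) z ∈ Submodule.span ℚ (Set.range fam) :=
  Iff.rfl

lemma Xg_mem_famSpan : Xg ∈ famSpan := Submodule.subset_span ⟨.inl 0, rfl⟩

lemma Yg_mem_famSpan : Yg ∈ famSpan := Submodule.subset_span ⟨.inl 1, rfl⟩

lemma longComm_mem_famSpan (k l : ℕ) : longComm k l ∈ famSpan :=
  Submodule.subset_span ⟨.inr (k, l), rfl⟩

lemma mem_famSpan_of_mem {z : L} (hz : z ∈ I) : z ∈ famSpan := by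
  have h : LieSubmodule.Quotient.mk (N := I) z = 0 := (LieSubmodule.Quotient.mk_eq_zero I).2 hz
  exact mem_famSpan.2 (h ▸ zero_mem _)

lemma lie_mem_famSpan_of_generators {w : L} (hX : ⁅w, Xg⁆ ∈ famSpan) (hY : ⁅w, Yg⁆ ∈ famSpan)
    (hc : ∀ k l, ⁅w, longComm k l⁆ ∈ famSpan) {z : L} (hz : z ∈ famSpan) : ⁅w, z⁆ ∈ famSpan := by
  suffices h : Submodule.span ℚ (Set.range fam) ≤
      (Submodule.span ℚ (Set.range fam)).comap
        (LieModule.toEnd ℚ L (L ⧸ I) w) from h hz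
  rw [Submodule.span_le]
  rintro _ ⟨i | ⟨k, l⟩, rfl⟩
  · fin_cases i
    · exact hX
    · exact hY
  · exact hc k l

lemma lie_Xg_mem_famSpan {z : L} (hz : z ∈ famSpan) : ⁅Xg, z⁆ ∈ famSpan := by
  refine lie_mem_famSpan_of_generators ?_ (longComm_mem_famSpan 0 0) (fun k l => ?_) hz
  · simp
  · exact lie_Xg_longComm k l ▸ longComm_mem_famSpan _ _

lemma lie_Yg_mem_famSpan {z : L} (hz : z ∈ famSpan) : ⁅Yg, z⁆ ∈ famSpan := by
  refine lie_mem_famSpan_of_generators ?_ ?_ (fun k l => ?_) hz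
  · rw [← lie_skew]
    exact neg_mem (longComm_mem_famSpan 0 0)
  · simp
  · simpa using add_mem (mem_famSpan_of_mem (lie_Yg_longComm_sub_mem k l))
      (longComm_mem_famSpan k (l + 1))

lemma lie_mem_famSpan (w : L) : ∀ z ∈ famSpan, ⁅w, z⁆ ∈ famSpan := by
  let K : LieSubalgebra ℚ L :=
    { carrier := {w | ∀ z ∈ famSpan, ⁅w, z⁆ ∈ famSpan}
      add_mem' := fun ha hb z hz => by
        rw [add_lie]
        exact add_mem (ha z hz) (hb z hz)
      zero_mem' := fun z _ => by simp
      smul_mem' := fun c a ha z hz => by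
        rw [smul_lie]
        exact Submodule.smul_mem _ c (ha z hz)
      lie_mem' := fun {a b} ha hb z hz => by
        rw [lie_lie]
        exact sub_mem (ha _ (hb z hz)) (hb _ (ha z hz)) }
  have hK : K = ⊤ := FreeLieAlgebra.lieSubalgebra_eq_top K <| Fin.forall_fin_two.2
    ⟨fun _ => lie_Xg_mem_famSpan, fun _ => lie_Yg_mem_famSpan⟩
  exact (hK ▸ LieSubalgebra.mem_top w : w ∈ K)

lemma famSpan_eq_top : famSpan = ⊤ := by
  let K : LieSubalgebra ℚ L := { famSpan with lie_mem' := fun _ hb => lie_mem_famSpan _ _ hb }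
  have hK : K = ⊤ := FreeLieAlgebra.lieSubalgebra_eq_top K <| Fin.forall_fin_two.2
    ⟨Xg_mem_famSpan, Yg_mem_famSpan⟩
  exact congrArg LieSubalgebra.toSubmodule hK

lemma span_range_fam : Submodule.span ℚ (Set.range fam) = ⊤ := by
  refine eq_top_iff.2 fun q _ => ?_
  obtain ⟨z, rfl⟩ := LieSubmodule.Quotient.surjective_mk' I q
  exact (famSpan_eq_top ▸ Submodule.mem_top : z ∈ famSpan)

open MvPolynomial in
/-- The homomorphism from `L` to the affine Lie algebra over `ℚ[x, y]` with `X ↦ (x, 0)` and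
`Y ↦ (y, 1)`. -/
def toAffine : L →ₗ⁅ℚ⁆ AffineLie (MvPolynomial (Fin 2) ℚ) :=
  FreeLieAlgebra.lift ℚ ![.mk (X 0) 0, .mk (X 1) 1]

open MvPolynomial in
lemma toAffine_Xg : toAffine Xg = .mk (X 0) 0 := by simp [toAffine, Xg]

open MvPolynomial in
lemma toAffine_Yg : toAffine Yg = .mk (X 1) 1 := by simp [toAffine, Yg]

open MvPolynomial in
lemma toAffine_longComm (k l : ℕ) :
    toAffine (longComm k l) =
      .mk 0 (monomial (Finsupp.single 0 (k + 1) + Finsupp.single 1 l) 1) := by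
  suffices h : toAffine (longComm k l) = .mk 0 (X 0 ^ (k + 1) * X 1 ^ l) by
    rw [h, X_pow_eq_monomial, X_pow_eq_monomial, monomial_mul, one_mul]
  induction k with
  | succ k ih =>
    rw [← lie_Xg_longComm, LieHom.map_lie, ih, toAffine_Xg]
    ext1 <;> simp
    ring
  | zero =>
    induction l with
    | succ l ih =>
      rw [← lie_Yg_longComm_zero, LieHom.map_lie, ih, toAffine_Yg]
      ext1 <;> simp
      ring
    | zero =>
      rw [longComm_zero_zero, LieHom.map_lie, toAffine_Xg, toAffine_Yg]
      ext1 <;> simp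

lemma le_ker_toAffine : I ≤ toAffine.ker := by
  rw [← LieIdeal.map_eq_bot_iff, eq_bot_iff, ← AffineLie.derivedSeries_two ℚ]
  exact LieIdeal.derivedSeries_map_le _

/-- The linear map `L ⧸ I → ℚ[x, y] × ℚ[x, y]` induced by `toAffine`. -/
def quotToAffine : L ⧸ I →ₗ[ℚ] AffineLie (MvPolynomial (Fin 2) ℚ) :=
  I.toSubmodule.liftQ toAffine.toLinearMap le_ker_toAffine

open MvPolynomial in
/-- The coordinate functionals dual to `fam`. -/
def famDual : Fin 2 ⊕ ℕ × ℕ → Module.Dual ℚ (L ⧸ I) :=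
  Sum.elim
    (fun i => lcoeff ℚ (Finsupp.single i 1) ∘ₗ AffineLie.fst _ ℚ ∘ₗ quotToAffine)
    (fun p => lcoeff ℚ (Finsupp.single 0 (p.1 + 1) + Finsupp.single 1 p.2) ∘ₗ
      AffineLie.snd _ ℚ ∘ₗ quotToAffine)

open MvPolynomial in
lemma linearIndependent_fam : LinearIndependent ℚ fam := by
  have hX : quotToAffine (fam (.inl 0)) = .mk (X 0) 0 := toAffine_Xg
  have hY : quotToAffine (fam (.inl 1)) = .mk (X 1) 1 := toAffine_Yg
  have hc (p : ℕ × ℕ) : quotToAffine (fam (.inr p)) =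
      .mk 0 (monomial (Finsupp.single 0 (p.1 + 1) + Finsupp.single 1 p.2) 1) :=
    toAffine_longComm p.1 p.2
  refine .of_pairwise_dual_eq_zero_one fam famDual ?_ ?_
  · rintro (i | ⟨k, l⟩) (j | ⟨k', l'⟩) hij
    · fin_cases i <;> fin_cases j <;>
        simp_all [famDual, coeff_X, Finsupp.single_left_inj]
    · simp [famDual, hc]
    · fin_cases j <;> simp [famDual, hX, hY, coeff_one, Finsupp.ext_iff]
    · simp [famDual, hc, coeff_monomial, Finsupp.ext_iff] at hij ⊢
      grind
  · rintro (i | ⟨k, l⟩)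
    · fin_cases i <;> simp [famDual, hX, hY]
    · simp [famDual, hc]

/-- Claim 3.1: the images of `X`, `Y` and the long commutators `[X^kY^lXY]`, `k,l ≥ 0`,
form a linear basis of the free metabelian Lie algebra `L̄ = L/⁅⁅L,L⁆,⁅L,L⁆⁆`. -/
theorem basis_of_free_metabelian_Lie_algebra :
    LinearIndependent ℚ fam ∧ Submodule.span ℚ (Set.range fam) = ⊤ := by
  exact ⟨linearIndependent_fam, span_range_fam⟩

end
end

section
/- Let L be the free Lie algebra over ℚ on generators X, Y, and for m,n ≥ 0 set {m,n} := (ad X)^m((ad Y)^{n+1}(X)) ∈ L (the long commutator [X^mY^{n+1}X]). Then for all m,n ≥ 0: (1) ⁅X, {m,n}⁆ = {m+1,n}; and (2) ⁅Y, {m,n}⁆ = {m,n+1} + ∑_{k=1}^{m} binom(m,k)·⁅{k−1,0}, {m−k,n}⁆. -/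
noncomputable section

/-- The long commutator `{m,n} = [X^mY^{n+1}X] = (ad X)^m ((ad Y)^{n+1} X)`. -/
def lc (m n : ℕ) : L :=
  (LieAlgebra.ad ℚ L Xg ^ m) ((LieAlgebra.ad ℚ L Yg ^ (n + 1)) Xg)

/-- The Leibniz rule for the powers of an inner derivation. -/
theorem LieAlgebra.ad_pow_apply_lie {R K : Type*} [CommRing R] [LieRing K] [LieAlgebra R K]
    (x a b : K) (n : ℕ) :
    (LieAlgebra.ad R K x ^ n) ⁅a, b⁆ = ∑ i ∈ Finset.range (n + 1),
      n.choose i • ⁅(LieAlgebra.ad R K x ^ i) a, (LieAlgebra.ad R K x ^ (n - i)) b⁆ := by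
  simp only [Module.End.pow_apply]
  have h : ⇑(LieDerivation.ad R K x) = ⇑(LieAlgebra.ad R K x) := by
    ext c
    simp
  rw [← h]
  exact LieDerivation.iterate_apply_lie' (LieDerivation.ad R K x) n a b

theorem lie_Xg_lc (m n : ℕ) : ⁅Xg, lc m n⁆ = lc (m + 1) n := by
  simp only [lc, pow_succ' _ m, Module.End.mul_apply, LieAlgebra.ad_apply]

theorem ad_Xg_pow_succ_Yg (k : ℕ) : (LieAlgebra.ad ℚ L Xg ^ (k + 1)) Yg = -lc k 0 := by
  rw [lc, pow_succ, Module.End.mul_apply, zero_add, pow_one, LieAlgebra.ad_apply,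
    LieAlgebra.ad_apply, ← lie_skew, map_neg]

theorem lc_succ_right (m n : ℕ) :
    lc m (n + 1) = (LieAlgebra.ad ℚ L Xg ^ m) ⁅Yg, lc 0 n⁆ := by
  simp only [lc, pow_succ' _ (n + 1), Module.End.mul_apply, LieAlgebra.ad_apply, pow_zero,
    Module.End.one_apply]

theorem ad_Xg_pow_lc_zero (m n : ℕ) : (LieAlgebra.ad ℚ L Xg ^ m) (lc 0 n) = lc m n := by
  simp only [lc, pow_zero, Module.End.one_apply]

/-- Lemma 3.6: in the free Lie algebra, (1) `⁅X, {m,n}⁆ = {m+1,n}` and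
(2) `⁅Y, {m,n}⁆ = {m,n+1} + ∑_{k=1}^{m} binom(m,k)·⁅{k−1,0}, {m−k,n}⁆`. -/
theorem action_on_long_commutators (m n : ℕ) :
    ⁅Xg, lc m n⁆ = lc (m + 1) n ∧
    ⁅Yg, lc m n⁆ = lc m (n + 1) +
      ∑ k ∈ Finset.Icc 1 m, (m.choose k) • ⁅lc (k - 1) 0, lc (m - k) n⁆ := by
  refine ⟨lie_Xg_lc m n, ?_⟩
  rw [lc_succ_right, LieAlgebra.ad_pow_apply_lie, Finset.sum_range_succ']
  have hI : Finset.Icc 1 m = Finset.Ico 1 (m + 1) := by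
    ext k
    simp
  rw [hI, Finset.sum_Ico_eq_sum_range]
  simp only [ad_Xg_pow_succ_Yg, ad_Xg_pow_lc_zero, add_comm 1, neg_lie, smul_neg,
    Finset.sum_neg_distrib, Nat.add_sub_cancel, Nat.choose_zero_right, one_smul, pow_zero,
    Module.End.one_apply, Nat.sub_zero]
  abel

end
end
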